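/- Let k > 0 be real and a_1, a_2, a_3 real numbers. Define f_{1,k}(t) := t^{k−1} e^{−i a_1 t}/Γ(k), f_{2,k}(t) := ∫_0^t f_{1,k}(τ)(t−τ)^{k−1} e^{−i a_2 (t−τ)}/Γ(k) dτ and f_{3,k}(t) := ∫_0^t f_{2,k}(τ)(t−τ)^{k−1} e^{−i a_3 (t−τ)}/Γ(k) dτ for t > 0. Then for every t > 0, f_{3,k}(t) = (t^{3k−1}/Γ(3k)) · e^{−i a_1 t} · Φ_2(k, k; 3k; i(a_1 − a_2)t, i(a_1 − a_3)t), where Φ_2(c_1, c_2; c_3; w, z) := Σ_{p=0}^∞ Σ_{q=0}^∞ [ (c_1)_p (c_2)_q / (c_3)_{p+q} ] · w^p z^q / (p! q!) is the Humbert confluent hypergeometric function of two variables ((c)_p denoting the Pochhammer symbol), the double series converging absolutely for all complex w, z. -/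

import Mathlib

open scoped BigOperators
open MeasureTheory

/-- The `n`-fold Laplace convolution `f_{n,k}` of the functions
`t ↦ t^{k−1} e^{−i a_j t}/Γ(k)`, `j = 1, …, n`. -/
noncomputable def laplaceConvPow (k : ℝ) (a : ℕ → ℝ) : ℕ → ℝ → ℂ
  | 0, _ => 0
  | 1, t => ((t ^ (k - 1) : ℝ) : ℂ) * Complex.exp (-Complex.I * (a 1 : ℂ) * (t : ℂ)) /
      ((Real.Gamma k : ℝ) : ℂ)
  | (j + 2), t => ∫ τ in (0 : ℝ)..t, laplaceConvPow k a (j + 1) τ *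
      ((((t - τ) ^ (k - 1) : ℝ) : ℂ) *
        Complex.exp (-Complex.I * (a (j + 2) : ℂ) * ((t : ℂ) - (τ : ℂ))) /
        ((Real.Gamma k : ℝ) : ℂ))

/-- The general term of the Humbert confluent hypergeometric double series
`Φ₂(c₁, c₂; c₃; w, z)`, with `(c)_p` the (ascending) Pochhammer symbol. -/
noncomputable def humbertPhi2Term (c1 c2 c3 : ℂ) (w z : ℂ) (pq : ℕ × ℕ) : ℂ :=
  ((ascPochhammer ℂ pq.1).eval c1 * (ascPochhammer ℂ pq.2).eval c2 /
      (ascPochhammer ℂ (pq.1 + pq.2)).eval c3) *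
    (w ^ pq.1 * z ^ pq.2 / ((pq.1.factorial : ℂ) * (pq.2.factorial : ℂ)))

/-- The Humbert confluent hypergeometric function of two variables
`Φ₂(c₁, c₂; c₃; w, z) = Σ_{p,q} (c₁)_p (c₂)_q / (c₃)_{p+q} · w^p z^q/(p! q!)`. -/
noncomputable def humbertPhi2 (c1 c2 c3 : ℂ) (w z : ℂ) : ℂ :=
  ∑' pq : ℕ × ℕ, humbertPhi2Term c1 c2 c3 w z pq

/-- The Riemann–Liouville kernel `t ↦ t^{α−1}/Γ(α)`. -/
noncomputable def powKernel (α t : ℝ) : ℝ := t ^ (α - 1) / Real.Gamma α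

lemma powKernel_pos {α t : ℝ} (hα : 0 < α) (ht : 0 < t) : 0 < powKernel α t :=
  div_pos (Real.rpow_pos_of_pos ht _) (Real.Gamma_pos_of_pos hα)

lemma ascPochhammer_eval_le {k x : ℝ} (hk : 0 < k) (hkx : k ≤ x) (n : ℕ) :
    (ascPochhammer ℝ n).eval k ≤ (ascPochhammer ℝ n).eval x := by
  induction n with
  | zero => simp
  | succ n ih =>
    rw [ascPochhammer_succ_eval, ascPochhammer_succ_eval]
    have := (ascPochhammer_pos n x (hk.trans_le hkx)).le
    gcongr

lemma ofReal_ascPochhammer_eval (n : ℕ) (x : ℝ) :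
    (((ascPochhammer ℝ n).eval x : ℝ) : ℂ) = (ascPochhammer ℂ n).eval (x : ℂ) := by
  induction n with
  | zero => simp
  | succ n ih =>
    rw [ascPochhammer_succ_eval, ascPochhammer_succ_eval]
    push_cast
    rw [ih]

/-- `(α)_n t^{α+n−1}/Γ(α+n) = t^n t^{α−1}/Γ(α)`. -/
lemma ascPochhammer_eval_mul_powKernel {α t : ℝ} (hα : 0 < α) (ht : 0 < t) (n : ℕ) :
    (ascPochhammer ℝ n).eval α * powKernel (α + n) t = t ^ n * powKernel α t := by
  induction n with
  | zero => simp
  | succ n ih =>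
    have hn : 0 < α + n := by positivity
    have key : (α + n) * powKernel (α + (n + 1 : ℕ)) t = t * powKernel (α + n) t := by
      have h1 : α + (n + 1 : ℕ) - 1 = (α + n - 1) + 1 := by push_cast; ring
      have h2 : α + (n + 1 : ℕ) = (α + n) + 1 := by push_cast; ring
      have := (Real.Gamma_pos_of_pos hn).ne'
      rw [powKernel, powKernel, h1, h2, Real.rpow_add_one ht.ne', Real.Gamma_add_one hn.ne']
      field_simp
    rw [ascPochhammer_succ_eval, mul_assoc, key, mul_left_comm, ih]
    ring

/-- The semigroup property of the Riemann–Liouville kernels under Laplace convolution. -/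
lemma integral_powKernel_mul {α β t : ℝ} (hα : 0 < α) (hβ : 0 < β) (ht : 0 < t) :
    ∫ τ in (0 : ℝ)..t, powKernel α τ * powKernel β (t - τ) = powKernel (α + β) t := by
  have hα' := (Real.Gamma_pos_of_pos hα).ne'
  have hβ' := (Real.Gamma_pos_of_pos hβ).ne'
  have hαβ' := (Real.Gamma_pos_of_pos (add_pos hα hβ)).ne'
  have h1 := Complex.betaIntegral_scaled (α : ℂ) (β : ℂ) ht
  have h2 := Complex.Gamma_mul_Gamma_eq_betaIntegral (s := (α : ℂ)) (t := (β : ℂ))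
    (by simpa using hα) (by simpa using hβ)
  have h3 : ∫ τ in (0 : ℝ)..t, (τ : ℂ) ^ ((α : ℂ) - 1) * ((t : ℂ) - τ) ^ ((β : ℂ) - 1)
      = ((∫ τ in (0 : ℝ)..t, τ ^ (α - 1) * (t - τ) ^ (β - 1) : ℝ) : ℂ) := by
    rw [← intervalIntegral.integral_ofReal]
    refine intervalIntegral.integral_congr fun τ hτ => ?_
    rw [Set.uIcc_of_le ht.le] at hτ
    rw [Complex.ofReal_mul, Complex.ofReal_cpow hτ.1, Complex.ofReal_cpow (by linarith [hτ.2])]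
    push_cast
    rfl
  have h4 : ((t : ℂ) ^ ((α : ℂ) + β - 1)) = ((t ^ (α + β - 1) : ℝ) : ℂ) := by
    rw [Complex.ofReal_cpow ht.le]
    push_cast
    rfl
  rw [h3, h4] at h1
  rw [Complex.Gamma_ofReal, Complex.Gamma_ofReal, ← Complex.ofReal_add, Complex.Gamma_ofReal] at h2
  have h5 : Real.Gamma α * Real.Gamma β * t ^ (α + β - 1)
      = Real.Gamma (α + β) * ∫ τ in (0 : ℝ)..t, τ ^ (α - 1) * (t - τ) ^ (β - 1) := by
    have : ((Real.Gamma α * Real.Gamma β * t ^ (α + β - 1) : ℝ) : ℂ)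
      = ((Real.Gamma (α + β) * ∫ τ in (0 : ℝ)..t, τ ^ (α - 1) * (t - τ) ^ (β - 1) : ℝ) : ℂ) := by
      rw [Complex.ofReal_mul, Complex.ofReal_mul, h2, Complex.ofReal_mul, h1]
      ring
    exact_mod_cast this
  calc ∫ τ in (0 : ℝ)..t, powKernel α τ * powKernel β (t - τ)
      = ∫ τ in (0 : ℝ)..t, (Real.Gamma α * Real.Gamma β)⁻¹ *
          (τ ^ (α - 1) * (t - τ) ^ (β - 1)) := by
        congr 1 with τ
        simp only [powKernel]
        field_simp
    _ = powKernel (α + β) t := by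
        rw [intervalIntegral.integral_const_mul, powKernel]
        field_simp
        linarith

lemma intervalIntegrable_powKernel_mul {α β t : ℝ} (hα : 0 < α) (hβ : 0 < β) (ht : 0 < t) :
    IntervalIntegrable (fun τ => powKernel α τ * powKernel β (t - τ)) volume 0 t := by
  by_contra h
  have h0 := integral_powKernel_mul hα hβ ht
  rw [intervalIntegral.integral_undef h] at h0
  exact (powKernel_pos (add_pos hα hβ) ht).ne h0

/-- The coefficients `(k)_q z^q / q!` of `(1 - zX)^{-k}`. -/
noncomputable def binomialCoeff (k : ℝ) (z : ℂ) (q : ℕ) : ℂ :=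
  ((ascPochhammer ℝ q).eval k : ℝ) * (z ^ q / (q.factorial : ℂ))

lemma norm_binomialCoeff {k : ℝ} (hk : 0 < k) (z : ℂ) (q : ℕ) :
    ‖binomialCoeff k z q‖ = (ascPochhammer ℝ q).eval k * (‖z‖ ^ q / q.factorial) := by
  rw [binomialCoeff, norm_mul, Complex.norm_real,
    Real.norm_of_nonneg (ascPochhammer_pos q k hk).le]
  simp

lemma powKernel_mul_expSeries {k s : ℝ} (hk : 0 < k) (hs : 0 < s) (z : ℂ) (q : ℕ) :
    (powKernel k s : ℂ) * ((z * s) ^ q / (q.factorial : ℂ))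
      = binomialCoeff k z q * (powKernel (k + q) s : ℂ) := by
  have h : (((ascPochhammer ℝ q).eval k : ℝ) : ℂ) * (powKernel (k + q) s : ℂ)
      = (s : ℂ) ^ q * (powKernel k s : ℂ) := by
    exact_mod_cast ascPochhammer_eval_mul_powKernel hk hs q
  rw [binomialCoeff, mul_pow]
  linear_combination -(z ^ q / (q.factorial : ℂ)) * h

section KernelSeries

variable {ι : Type*} {c : ι → ℂ} {d : ι → ℕ} {α k : ℝ}

lemma summable_kernelSeries_prod (hα : 0 < α) (hk : 0 < k) (z : ℂ) {t : ℝ} (ht : 0 < t)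
    (hc : Summable fun i => ‖c i‖ * powKernel (α + d i) t) :
    Summable fun p : ι × ℕ =>
      ‖c p.1 * binomialCoeff k z p.2‖ * powKernel (α + k + (d p.1 + p.2 : ℕ)) t := by
  have hexp : Summable fun q : ℕ => (‖z‖ * t) ^ q / q.factorial :=
    Real.summable_pow_div_factorial _
  have hC := powKernel_pos hα ht
  have hαk := add_pos hα hk
  refine Summable.of_nonneg_of_le (fun p => ?_) (fun p => ?_)
    (((hc.mul_of_nonneg hexp ?_ ?_)).mul_left (powKernel (α + k) t / powKernel α t))
  · have := powKernel_pos (α := α + k + (d p.1 + p.2 : ℕ)) (by positivity) ht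
    positivity
  · obtain ⟨i, q⟩ := p
    have hd : 0 < α + k + d i := by positivity
    have hP := powKernel_pos (α := α + k + d i + q) (by positivity) ht
    have hQ := powKernel_pos hd ht
    have h1 : (ascPochhammer ℝ q).eval k * powKernel (α + k + d i + q) t
        ≤ t ^ q * powKernel (α + k + d i) t := by
      rw [← ascPochhammer_eval_mul_powKernel hd ht q]
      gcongr
      exact ascPochhammer_eval_le hk (by linarith [(d i).cast_nonneg (α := ℝ)]) q
    have h2 : powKernel (α + k + d i) t
        ≤ powKernel (α + k) t / powKernel α t * powKernel (α + d i) t := by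
      have e1 := ascPochhammer_eval_mul_powKernel hα ht (d i)
      have e2 := ascPochhammer_eval_mul_powKernel hαk ht (d i)
      have e3 := ascPochhammer_eval_le hα (by linarith : α ≤ α + k) (d i)
      have p1 := ascPochhammer_pos (d i) α hα
      rw [div_mul_eq_mul_div, le_div_iff₀ hC]
      refine le_of_mul_le_mul_left ?_ p1
      calc _ ≤ (ascPochhammer ℝ (d i)).eval (α + k) *
              (powKernel (α + k + d i) t * powKernel α t) := by gcongr
        _ = powKernel (α + k) t * (t ^ d i * powKernel α t) := by
              rw [← mul_assoc, e2]; ring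
        _ = _ := by rw [← e1]; ring
    dsimp only
    rw [norm_mul, norm_binomialCoeff hk, Nat.cast_add, ← add_assoc]
    calc _ = ‖c i‖ * (‖z‖ ^ q / q.factorial) *
          ((ascPochhammer ℝ q).eval k * powKernel (α + k + d i + q) t) := by ring
      _ ≤ ‖c i‖ * (‖z‖ ^ q / q.factorial) * (t ^ q *
          (powKernel (α + k) t / powKernel α t * powKernel (α + d i) t)) := by
            exact mul_le_mul_of_nonneg_left (h1.trans (by gcongr)) (by positivity)
      _ = _ := by rw [mul_pow]; ring
  · intro i
    have := powKernel_pos (α := α + d i) (by positivity) ht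
    positivity
  · intro q
    positivity

/-- Termwise Laplace convolution of a series of powers with `t^{k-1} e^{zt}/Γ(k)`. -/
lemma integral_kernelSeries_mul_exp [Countable ι] (hα : 0 < α) (hk : 0 < k) (z : ℂ)
    (hc : ∀ t, 0 < t → Summable fun i => ‖c i‖ * powKernel (α + d i) t) {t : ℝ} (ht : 0 < t) :
    ∫ τ in (0 : ℝ)..t, (∑' i, c i * (powKernel (α + d i) τ : ℂ)) *
        ((powKernel k (t - τ) : ℂ) * Complex.exp (z * ((t : ℂ) - τ)))
      = ∑' p : ι × ℕ, c p.1 * binomialCoeff k z p.2 *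
          (powKernel (α + k + (d p.1 + p.2 : ℕ)) t : ℂ) := by
  set F : ι × ℕ → ℝ → ℝ := fun p τ =>
    powKernel (α + d p.1) τ * powKernel (k + p.2) (t - τ) with hF
  set C : ι × ℕ → ℂ := fun p => c p.1 * binomialCoeff k z p.2 with hC
  have hdpos : ∀ i, 0 < α + d i := fun i => by positivity
  have hkpos : ∀ q : ℕ, 0 < k + q := fun q => by positivity
  have hFnonneg : ∀ p, ∀ τ ∈ Set.Ioo 0 t, 0 ≤ F p τ := fun p τ hτ =>
    mul_nonneg (powKernel_pos (hdpos _) hτ.1).le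
      (powKernel_pos (hkpos _) (sub_pos.2 hτ.2)).le
  have hFint : ∀ p, IntegrableOn (F p) (Set.Ioo 0 t) := fun p =>
    (((intervalIntegrable_iff_integrableOn_Ioc_of_le ht.le).1
      (intervalIntegrable_powKernel_mul (hdpos p.1) (hkpos p.2) ht))).mono_set
        Set.Ioo_subset_Ioc_self
  have hFval : ∀ p, ∫ τ in Set.Ioo 0 t, F p τ = powKernel (α + k + (d p.1 + p.2 : ℕ)) t := by
    intro p
    rw [← integral_Ioc_eq_integral_Ioo, ← intervalIntegral.integral_of_le ht.le,
      integral_powKernel_mul (hdpos p.1) (hkpos p.2) ht]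
    congr 1
    push_cast
    ring
  have hsum : Summable fun p => ∫ τ in Set.Ioo 0 t, ‖C p * (F p τ : ℂ)‖ := by
    refine (summable_kernelSeries_prod hα hk z ht (hc t ht)).congr fun p => ?_
    rw [← hFval p, ← integral_const_mul]
    refine setIntegral_congr_fun measurableSet_Ioo fun τ hτ => ?_
    rw [norm_mul (C p), Complex.norm_real, Real.norm_of_nonneg (hFnonneg p τ hτ)]
  have key := hasSum_integral_of_summable_integral_norm
    (fun p => ((hFint p).ofReal (𝕜 := ℂ)).const_mul (C p)) hsum
  rw [intervalIntegral.integral_of_le ht.le, integral_Ioc_eq_integral_Ioo]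
  calc _ = ∫ τ in Set.Ioo 0 t, ∑' p, C p * (F p τ : ℂ) := by
        refine setIntegral_congr_fun measurableSet_Ioo fun τ hτ => ?_
        have hs : 0 < t - τ := sub_pos.2 hτ.2
        have hexp : Complex.exp (z * ((t : ℂ) - τ))
            = ∑' q : ℕ, (z * ((t - τ : ℝ) : ℂ)) ^ q / (q.factorial : ℂ) := by
          rw [Complex.exp_eq_exp_ℂ, NormedSpace.exp_eq_tsum_div]
          push_cast
          rfl
        rw [hexp, ← tsum_mul_left, tsum_mul_tsum_of_summable_norm]
        · refine tsum_congr fun p => ?_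
          rw [powKernel_mul_expSeries hk hs, hC, hF]
          push_cast
          ring
        · refine (hc τ hτ.1).congr fun i => ?_
          rw [norm_mul, Complex.norm_real, Real.norm_of_nonneg (powKernel_pos (hdpos i) hτ.1).le]
        · simp_rw [norm_mul]
          exact (NormedSpace.norm_expSeries_div_summable _).mul_left _
    _ = ∑' p, ∫ τ in Set.Ioo 0 t, C p * (F p τ : ℂ) := key.tsum_eq.symm
    _ = _ := by
        refine tsum_congr fun p => ?_
        rw [integral_const_mul, ← hFval p]
        congr 1
        exact integral_ofReal

/-- One more Laplace convolution turns a kernel series for `f_{j+1,k}` into one for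
`f_{j+2,k}`. -/
lemma laplaceConvPow_succ_eq_kernelSeries [Countable ι] (hα : 0 < α) (hk : 0 < k) (a : ℕ → ℝ)
    (j : ℕ) (hc : ∀ t, 0 < t → Summable fun i => ‖c i‖ * powKernel (α + d i) t)
    (hj : ∀ t, 0 < t → laplaceConvPow k a (j + 1) t
      = Complex.exp (-Complex.I * a 1 * t) * ∑' i, c i * (powKernel (α + d i) t : ℂ))
    {t : ℝ} (ht : 0 < t) :
    laplaceConvPow k a (j + 2) t = Complex.exp (-Complex.I * a 1 * t) *
      ∑' p : ι × ℕ, c p.1 * binomialCoeff k (Complex.I * ((a 1 : ℂ) - a (j + 2))) p.2 *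
          (powKernel (α + k + (d p.1 + p.2 : ℕ)) t : ℂ) := by
  rw [laplaceConvPow, ← integral_kernelSeries_mul_exp hα hk _ hc ht,
    ← intervalIntegral.integral_const_mul, intervalIntegral.integral_of_le ht.le,
    intervalIntegral.integral_of_le ht.le]
  refine setIntegral_congr_fun measurableSet_Ioc fun τ hτ => ?_
  have hexp : Complex.exp (-Complex.I * a 1 * τ) *
        Complex.exp (-Complex.I * a (j + 2) * ((t : ℂ) - τ))
      = Complex.exp (-Complex.I * a 1 * t) *
        Complex.exp (Complex.I * ((a 1 : ℂ) - a (j + 2)) * ((t : ℂ) - τ)) := by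
    rw [← Complex.exp_add, ← Complex.exp_add]
    congr 1
    ring
  rw [hj τ hτ.1, powKernel]
  push_cast
  linear_combination (∑' i, c i * (powKernel (α + d i) τ : ℂ)) *
    (((t - τ) ^ (k - 1) : ℝ) / (Real.Gamma k : ℂ)) * hexp

end KernelSeries

lemma summable_kernelSeries_three {k t : ℝ} (hk : 0 < k) (ht : 0 < t) (w z : ℂ) :
    Summable fun p : ℕ × ℕ =>
      ‖binomialCoeff k w p.1 * binomialCoeff k z p.2‖ *
        powKernel (3 * k + (p.1 + p.2 : ℕ)) t := by
  have h1 := summable_kernelSeries_prod (ι := Unit) (c := fun _ => 1) (d := fun _ => 0)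
    hk hk w ht (.of_finite)
  have h2 : Summable fun p : ℕ => ‖binomialCoeff k w p‖ * powKernel (k + k + p) t := by
    simpa [Function.comp_def] using h1.comp_injective (Prod.mk_right_injective ())
  have h3 := summable_kernelSeries_prod (d := fun p : ℕ => p) (add_pos hk hk) hk z ht h2
  rwa [show k + k + k = 3 * k by ring] at h3

lemma humbertPhi2Term_mul_powKernel {k t : ℝ} (hk : 0 < k) (ht : 0 < t) (w z : ℂ)
    (p : ℕ × ℕ) :
    (powKernel (3 * k) t : ℂ) * humbertPhi2Term k k ((3 * k : ℝ) : ℂ) (w * t) (z * t) p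
      = binomialCoeff k w p.1 * binomialCoeff k z p.2 *
        (powKernel (3 * k + (p.1 + p.2 : ℕ)) t : ℂ) := by
  have h3k : 0 < 3 * k := by positivity
  have h : (((ascPochhammer ℝ (p.1 + p.2)).eval (3 * k) : ℝ) : ℂ) *
      (powKernel (3 * k + (p.1 + p.2 : ℕ)) t : ℂ)
      = (t : ℂ) ^ (p.1 + p.2) * (powKernel (3 * k) t : ℂ) := by
    exact_mod_cast ascPochhammer_eval_mul_powKernel h3k ht (p.1 + p.2)
  have hne : (((ascPochhammer ℝ (p.1 + p.2)).eval (3 * k) : ℝ) : ℂ) ≠ 0 := by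
    exact_mod_cast (ascPochhammer_pos (p.1 + p.2) (3 * k) h3k).ne'
  rw [humbertPhi2Term, ← ofReal_ascPochhammer_eval, ← ofReal_ascPochhammer_eval,
    ← ofReal_ascPochhammer_eval, binomialCoeff, binomialCoeff,
    eq_div_of_mul_eq hne ((mul_comm _ _).trans h), mul_pow, mul_pow, pow_add]
  ring

/-- Absolute convergence of the Humbert series `Φ₂(k, k; 3k; w, z)`. -/
lemma summable_norm_humbertPhi2Term {k : ℝ} (hk : 0 < k) (w z : ℂ) :
    Summable fun p => ‖humbertPhi2Term k k ((3 * k : ℝ) : ℂ) w z p‖ := by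
  have hpos := powKernel_pos (α := 3 * k) (by positivity) one_pos
  refine (summable_mul_left_iff hpos.ne').1 <|
    (summable_kernelSeries_three hk one_pos w z).congr fun p => ?_
  have h := congrArg norm (humbertPhi2Term_mul_powKernel hk one_pos w z p)
  have hpos' := powKernel_pos (α := 3 * k + (p.1 + p.2 : ℕ)) (by positivity) one_pos
  rw [norm_mul, norm_mul _ (Complex.ofReal _), Complex.norm_real, Complex.norm_real,
    Real.norm_of_nonneg hpos.le, Real.norm_of_nonneg hpos'.le] at h
  simpa using h.symm

/-- `f_{3,k}` as a double series of Riemann–Liouville kernels. -/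
lemma laplaceConvPow_three_eq_kernelSeries {k t : ℝ} (hk : 0 < k) (ht : 0 < t) (a : ℕ → ℝ) :
    laplaceConvPow k a 3 t = Complex.exp (-Complex.I * a 1 * t) *
      ∑' p : ℕ × ℕ, binomialCoeff k (Complex.I * ((a 1 : ℂ) - a 2)) p.1 *
        binomialCoeff k (Complex.I * ((a 1 : ℂ) - a 3)) p.2 *
          (powKernel (3 * k + (p.1 + p.2 : ℕ)) t : ℂ) := by
  have h2 : ∀ s, 0 < s → laplaceConvPow k a 2 s = Complex.exp (-Complex.I * a 1 * s) *
      ∑' p : ℕ, binomialCoeff k (Complex.I * ((a 1 : ℂ) - a 2)) p *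
        (powKernel (k + k + p) s : ℂ) := by
    intro s hs
    rw [laplaceConvPow_succ_eq_kernelSeries (ι := Unit) (c := fun _ => 1) (d := fun _ => 0)
      hk hk a 0 (fun _ _ => .of_finite) ?_ hs, ← (Equiv.punitProd ℕ).symm.tsum_eq]
    · simp
    · intro τ _
      simp [laplaceConvPow, powKernel, mul_div_assoc, mul_comm, mul_left_comm]
  have h2sum : ∀ s, 0 < s → Summable fun p : ℕ =>
      ‖binomialCoeff k (Complex.I * ((a 1 : ℂ) - a 2)) p‖ * powKernel (k + k + p) s := by
    intro s hs
    have := summable_kernelSeries_prod (ι := Unit) (c := fun _ => 1) (d := fun _ => 0)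
      hk hk (Complex.I * ((a 1 : ℂ) - a 2)) hs (.of_finite)
    simpa [Function.comp_def] using this.comp_injective (Prod.mk_right_injective ())
  rw [laplaceConvPow_succ_eq_kernelSeries (d := fun p : ℕ => p) (add_pos hk hk) hk a 1
    h2sum h2 ht, show k + k + k = 3 * k by ring]

/-- **The triple Laplace convolution `f_{3,k}` in terms of the Humbert `Φ₂`
function** (formula (22) in the paper): for real `k > 0` and real `a₁, a₂, a₃`, the
Humbert double series converges absolutely for all complex arguments and, for every
`t > 0`, `f_{3,k}(t) = (t^{3k−1}/Γ(3k)) e^{−i a₁ t}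
Φ₂(k, k; 3k; i(a₁−a₂)t, i(a₁−a₃)t)`. -/
theorem laplaceConvPow_three_humbert
    (k : ℝ) (hk : 0 < k) (a : ℕ → ℝ) :
    (∀ w z : ℂ, Summable (fun pq : ℕ × ℕ =>
        ‖humbertPhi2Term (k : ℂ) (k : ℂ) ((3 * k : ℝ) : ℂ) w z pq‖)) ∧
    (∀ t : ℝ, 0 < t →
      laplaceConvPow k a 3 t
        = (((t ^ (3 * k - 1) : ℝ) : ℂ) / ((Real.Gamma (3 * k) : ℝ) : ℂ)) *
            Complex.exp (-Complex.I * (a 1 : ℂ) * (t : ℂ)) *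
            humbertPhi2 (k : ℂ) (k : ℂ) ((3 * k : ℝ) : ℂ)
              (Complex.I * ((a 1 : ℂ) - (a 2 : ℂ)) * (t : ℂ))
              (Complex.I * ((a 1 : ℂ) - (a 3 : ℂ)) * (t : ℂ))) := by
  refine ⟨summable_norm_humbertPhi2Term hk, fun t ht => ?_⟩
  rw [laplaceConvPow_three_eq_kernelSeries hk ht, humbertPhi2, ← Complex.ofReal_div,
    ← powKernel, mul_comm (powKernel (3 * k) t : ℂ), mul_assoc (Complex.exp _)]
  congr 1
  rw [← tsum_mul_left]
  exact tsum_congr fun p => (humbertPhi2Term_mul_powKernel hk ht _ _ p).symm
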